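/- Under the centered functional quadratic model, assume the error ε has an even density that is non-increasing in |t| and strictly decreasing for |t| in a neighbourhood of 0, and let ρ₁ be a bounded ρ-function. Then for every σ > 0, every a ∈ ℝ, every β ∈ L²(0,1) and every self-adjoint Hilbert–Schmidt operator Υ, one has L(a, β, Υ, μ, σ) ≥ L(α₀, β₀, Υ₀, μ, σ) = E[ρ₁(ε σ₀/σ)]. -/

import Mathlib

open MeasureTheory Filter
open scoped RealInnerProductSpace ENNReal

noncomputable section

/-- A *bounded ρ-function*: bounded, continuous, even, non-decreasing on `[0,∞)`,
vanishing at `0`, with supremum `1`, and strictly increasing where it is below `1`. -/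
def IsBoundedRho (ρ : ℝ → ℝ) : Prop :=
  (∀ t, 0 ≤ ρ t) ∧ (∀ t, ρ t ≤ 1) ∧ Continuous ρ ∧ (∀ t, ρ (-t) = ρ t) ∧
    MonotoneOn ρ (Set.Ici (0 : ℝ)) ∧ ρ 0 = 0 ∧ (⨆ t, ρ t) = 1 ∧
    ∀ u v : ℝ, 0 ≤ u → u < v → ρ v < 1 → ρ u < ρ v

/-- The error has an even density `f₀`, non-increasing in `|t|` and strictly decreasing
for `|t|` in a neighbourhood of `0`. -/
def HasSymmUnimodalDensity {Ω : Type*} [MeasureSpace Ω] (ε : Ω → ℝ) : Prop :=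
  ∃ f₀ : ℝ → ℝ, (∀ t, 0 ≤ f₀ t) ∧
    Measure.map ε (volume : Measure Ω)
      = (volume : Measure ℝ).withDensity (fun t => ENNReal.ofReal (f₀ t)) ∧
    (∀ t, f₀ (-t) = f₀ t) ∧ (∀ s t : ℝ, |s| ≤ |t| → f₀ t ≤ f₀ s) ∧
    ∃ δ : ℝ, 0 < δ ∧ ∀ s t : ℝ, 0 ≤ s → s < t → t ≤ δ → f₀ t < f₀ s

variable {H : Type*} [NormedAddCommGroup H] [InnerProductSpace ℝ H]

/-- The rank-one operator `f ⊗ g : u ↦ ⟪f, u⟫ • g`. -/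
def rankOne (f g : H) : H →L[ℝ] H := (innerSL ℝ f).smulRight g

/-- Membership in `H_p`, the linear span of `φ 0, …, φ (p-1)`. -/
def inSpan (φ : ℕ → H) (p : ℕ) (β : H) : Prop :=
  ∃ bcoef : Fin p → ℝ, β = ∑ j : Fin p, bcoef j • φ (j : ℕ)

/-- Membership in `F_p`, the symmetric operators spanned by `φ j ⊗ φ ℓ`, `j, ℓ < p`. -/
def inFSpan (φ : ℕ → H) (p : ℕ) (Υ : H →L[ℝ] H) : Prop :=
  ∃ v : Fin p → Fin p → ℝ, (∀ j ℓ, v j ℓ = v ℓ j) ∧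
    Υ = ∑ j : Fin p, ∑ ℓ : Fin p, v j ℓ • rankOne (φ (j : ℕ)) (φ (ℓ : ℕ))

/-- `T` is a Hilbert–Schmidt operator. -/
def IsHilbertSchmidt (T : H →L[ℝ] H) : Prop :=
  ∃ b : HilbertBasis ℕ ℝ H, Summable fun i => ‖T (b i)‖ ^ 2

/-- The Hilbert–Schmidt norm of `T`, computed in the Hilbert basis `b`. -/
def hsNorm (b : HilbertBasis ℕ ℝ H) (T : H →L[ℝ] H) : ℝ :=
  Real.sqrt (∑' i, ‖T (b i)‖ ^ 2)

/-- The risk `L(a, β, Υ, ν, σ) = E ρ₁((y − a − ⟨X−ν, β⟩ − ⟨X−ν, Υ(X−ν)⟩)/σ)`. -/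
def risk {Ω : Type*} [MeasureSpace Ω]
    (ρ₁ : ℝ → ℝ) (y : Ω → ℝ) (X : Ω → H) (a : ℝ) (β : H) (Υ : H →L[ℝ] H)
    (ν : H) (σ : ℝ) : ℝ :=
  ∫ ω, ρ₁ ((y ω - a - ⟪X ω - ν, β⟫ - ⟪X ω - ν, Υ (X ω - ν)⟫) / σ)

/-- One-dimensional Anderson inequality: shifting an even function that is non-decreasing in `|t|`
does not decrease its integral against an even weight that is non-increasing in `|t|`. -/
theorem integral_mul_le_integral_shift_mul {h f : ℝ → ℝ}
    (h_mono : ∀ s t : ℝ, |s| ≤ |t| → h s ≤ h t) (f_anti : ∀ s t : ℝ, |s| ≤ |t| → f t ≤ f s)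
    (h_int : ∀ t, Integrable fun e => h (e + t) * f e) (t : ℝ) :
    ∫ e, h e * f e ≤ ∫ e, h (e + t) * f e := by
  have h_even : ∀ s, h (-s) = h s := fun s =>
    le_antisymm (h_mono _ _ (abs_neg s).le) (h_mono _ _ (abs_neg s).ge)
  have f_even : ∀ s, f (-s) = f s := fun s =>
    le_antisymm (f_anti _ _ (abs_neg s).ge) (f_anti _ _ (abs_neg s).le)
  have h_int₀ : Integrable fun e => h e * f e := by simpa using h_int 0
  set ψ : ℝ → ℝ := fun e => h (e + t) * f e - h e * f e with hψ
  have ψ_int : Integrable ψ := (h_int t).sub h_int₀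
  have ψ_refl : ∫ e, ψ (-t - e) = ∫ e, ψ e := integral_sub_left_eq_self ψ volume (-t)
  have ψ_sum : 0 ≤ ∫ e, (ψ e + ψ (-t - e)) := by
    refine integral_nonneg fun e => ?_
    have h₁ : h (-t - e + t) = h e := by rw [← h_even e]; congr 1; ring
    have h₂ : h (-t - e) = h (e + t) := by rw [← h_even (e + t)]; congr 1; ring
    have h₃ : f (-t - e) = f (e + t) := by rw [← f_even (e + t)]; congr 1; ring
    simp only [hψ, h₁, h₂, h₃, Pi.zero_apply]
    rcases le_total |e| |e + t| with hle | hle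
    · nlinarith [mul_nonneg (sub_nonneg.2 (h_mono _ _ hle)) (sub_nonneg.2 (f_anti _ _ hle))]
    · nlinarith [mul_nonneg (sub_nonneg.2 (h_mono _ _ hle)) (sub_nonneg.2 (f_anti _ _ hle))]
  rw [integral_add ψ_int (ψ_int.comp_sub_left (-t)), ψ_refl] at ψ_sum
  have ψ_eq : ∫ e, ψ e = (∫ e, h (e + t) * f e) - ∫ e, h e * f e :=
    integral_sub (h_int t) h_int₀
  linarith

theorem measurable_of_antitone_abs {f : ℝ → ℝ} (f_anti : ∀ s t : ℝ, |s| ≤ |t| → f t ≤ f s) :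
    Measurable f := by
  have h_anti : Antitone fun x : ℝ => f (max x 0) := fun x z hxz => f_anti _ _ <| by
    rw [abs_of_nonneg (le_max_right x 0), abs_of_nonneg (le_max_right z 0)]
    exact max_le_max_right 0 hxz
  have h_eq : f = (fun x : ℝ => f (max x 0)) ∘ fun x => |x| := by
    ext x
    simp only [Function.comp_apply, max_eq_left (abs_nonneg x)]
    exact le_antisymm (f_anti _ _ (abs_abs x).le) (f_anti _ _ (abs_abs x).ge)
  rw [h_eq]
  exact h_anti.measurable.comp measurable_abs

theorem IsBoundedRho.le_of_abs_le {ρ : ℝ → ℝ} (hρ : IsBoundedRho ρ) {s t : ℝ}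
    (hst : |s| ≤ |t|) : ρ s ≤ ρ t := by
  obtain ⟨-, -, -, ρ_even, ρ_mono, -⟩ := hρ
  have ρ_abs : ∀ x, ρ |x| = ρ x := fun x => by
    rcases abs_choice x with hx | hx <;> rw [hx]
    exact ρ_even x
  rw [← ρ_abs s, ← ρ_abs t]
  exact ρ_mono (abs_nonneg s) (abs_nonneg t) hst

theorem IsBoundedRho.integrable_comp {α : Type*} [MeasurableSpace α] {P : Measure α}
    [IsFiniteMeasure P] {ρ : ℝ → ℝ} (hρ : IsBoundedRho ρ) {g : α → ℝ} (hg : Measurable g) :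
    Integrable (fun x => ρ (g x)) P :=
  Integrable.of_bound (hρ.2.2.1.measurable.comp hg).aestronglyMeasurable 1 <|
    Eventually.of_forall fun x => by
      rw [Real.norm_of_nonneg (hρ.1 _)]
      exact hρ.2.1 _

/-- Shifting a symmetric unimodal error does not decrease its expected `ρ`-loss. -/
theorem HasSymmUnimodalDensity.integral_rho_le {Ω : Type*} [MeasureSpace Ω]
    [IsProbabilityMeasure (volume : Measure Ω)] {ε : Ω → ℝ} (hε : Measurable ε)
    (hdens : HasSymmUnimodalDensity ε) {ρ : ℝ → ℝ} (hρ : IsBoundedRho ρ) (c t : ℝ) :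
    ∫ e, ρ (c * e) ∂(volume.map ε) ≤ ∫ e, ρ (c * (e + t)) ∂(volume.map ε) := by
  have : IsProbabilityMeasure (volume.map ε) := Measure.isProbabilityMeasure_map hε.aemeasurable
  have ρ_int : ∀ t : ℝ, Integrable (fun e => ρ (c * (e + t))) (volume.map ε) := fun t =>
    hρ.integrable_comp (by fun_prop)
  obtain ⟨f, f_nonneg, h_map, -, f_anti, -⟩ := hdens
  have f_meas : Measurable fun e => ENNReal.ofReal (f e) :=
    (measurable_of_antitone_abs f_anti).ennreal_ofReal
  have f_fin : ∀ᵐ e : ℝ, ENNReal.ofReal (f e) < ∞ := .of_forall fun _ => ENNReal.ofReal_lt_top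
  rw [h_map] at ρ_int ⊢
  simp only [integrable_withDensity_iff f_meas f_fin,
    ENNReal.toReal_ofReal (f_nonneg _)] at ρ_int
  simp only [integral_withDensity_eq_integral_toReal_smul f_meas f_fin,
    ENNReal.toReal_ofReal (f_nonneg _), smul_eq_mul, mul_comm (f _)]
  refine integral_mul_le_integral_shift_mul (h := fun e => ρ (c * e))
    (fun s t hst => hρ.le_of_abs_le ?_) f_anti ρ_int t
  rw [abs_mul, abs_mul]
  exact mul_le_mul_of_nonneg_left hst (abs_nonneg c)

/-- Adding an independent perturbation to a symmetric unimodal error does not decrease its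
expected `ρ`-loss. -/
theorem HasSymmUnimodalDensity.integral_rho_le_of_indepFun {Ω : Type*} [MeasureSpace Ω]
    [IsProbabilityMeasure (volume : Measure Ω)] {ε Z : Ω → ℝ} (hε : Measurable ε)
    (hZ : Measurable Z) (hindep : ProbabilityTheory.IndepFun ε Z (volume : Measure Ω))
    (hdens : HasSymmUnimodalDensity ε) {ρ : ℝ → ℝ} (hρ : IsBoundedRho ρ) (c : ℝ) :
    ∫ ω, ρ (c * ε ω) ≤ ∫ ω, ρ (c * (ε ω + Z ω)) := by
  have : IsProbabilityMeasure (volume.map ε) := Measure.isProbabilityMeasure_map hε.aemeasurable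
  have : IsProbabilityMeasure (volume.map Z) := Measure.isProbabilityMeasure_map hZ.aemeasurable
  have ρ_meas : Measurable ρ := hρ.2.2.1.measurable
  have F_meas : Measurable fun p : ℝ × ℝ => ρ (c * (p.1 + p.2)) := by fun_prop
  have F_int : Integrable (fun p : ℝ × ℝ => ρ (c * (p.1 + p.2)))
      ((volume.map ε).prod (volume.map Z)) := hρ.integrable_comp (by fun_prop)
  have h_left : ∫ ω, ρ (c * ε ω) = ∫ e, ρ (c * e) ∂(volume.map ε) :=
    (integral_map (f := fun e => ρ (c * e)) hε.aemeasurable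
      (by fun_prop : Measurable fun e => ρ (c * e)).aestronglyMeasurable).symm
  have h_right : ∫ ω, ρ (c * (ε ω + Z ω))
      = ∫ z, ∫ e, ρ (c * (e + z)) ∂(volume.map ε) ∂(volume.map Z) := by
    rw [← integral_prod_symm (fun p : ℝ × ℝ => ρ (c * (p.1 + p.2))) F_int,
      ← (ProbabilityTheory.indepFun_iff_map_prod_eq_prod_map_map hε.aemeasurable
        hZ.aemeasurable).1 hindep,
      integral_map (hε.prodMk hZ).aemeasurable F_meas.aestronglyMeasurable]
  rw [h_left, h_right]
  calc ∫ e, ρ (c * e) ∂(volume.map ε)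
      = ∫ _, (∫ e, ρ (c * e) ∂(volume.map ε)) ∂(volume.map Z) := by simp
    _ ≤ _ := integral_mono (integrable_const _) F_int.integral_prod_right
        fun z => hdens.integral_rho_le hε hρ c z

/-- under the centered functional quadratic model, the risk is minimized at
the true parameters: for every `σ > 0` and every candidate `(a, β, Υ)` with `Υ` self-adjoint
Hilbert–Schmidt, `L(a, β, Υ, μ, σ) ≥ L(α₀, β₀, Υ₀, μ, σ) = E[ρ₁(ε σ₀/σ)]`. -/
theorem statement4
    {Ω H : Type*} [MeasureSpace Ω] [IsProbabilityMeasure (volume : Measure Ω)]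
    [NormedAddCommGroup H] [InnerProductSpace ℝ H] [CompleteSpace H]
    [MeasurableSpace H] [BorelSpace H]
    (X : Ω → H) (ε y : Ω → ℝ) (hX : Measurable X) (hε : Measurable ε)
    (μ : H) (α₀ : ℝ) (β₀ : H) (Υ₀ : H →L[ℝ] H) (σ₀ : ℝ) (hσ₀ : 0 < σ₀)
    (hsa₀ : ∀ u v : H, ⟪Υ₀ u, v⟫ = ⟪u, Υ₀ v⟫) (hHS₀ : IsHilbertSchmidt Υ₀)
    (hmodel : ∀ ω, y ω = α₀ + ⟪β₀, X ω - μ⟫ + ⟪X ω - μ, Υ₀ (X ω - μ)⟫ + σ₀ * ε ω)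
    (hindep : ProbabilityTheory.IndepFun ε X (volume : Measure Ω))
    (hdens : HasSymmUnimodalDensity ε)
    (ρ₁ : ℝ → ℝ) (hρ₁ : IsBoundedRho ρ₁) :
    ∀ σ : ℝ, 0 < σ →
      (∀ (a : ℝ) (β : H) (Υ : H →L[ℝ] H),
          (∀ u v : H, ⟪Υ u, v⟫ = ⟪u, Υ v⟫) → IsHilbertSchmidt Υ →
          risk ρ₁ y X α₀ β₀ Υ₀ μ σ ≤ risk ρ₁ y X a β Υ μ σ) ∧
      risk ρ₁ y X α₀ β₀ Υ₀ μ σ = ∫ ω, ρ₁ (ε ω * σ₀ / σ) := by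
  intro σ hσ
  have h_true : risk ρ₁ y X α₀ β₀ Υ₀ μ σ = ∫ ω, ρ₁ (ε ω * σ₀ / σ) := by
    refine integral_congr_ae (.of_forall fun ω => ?_)
    simp only [hmodel, real_inner_comm β₀]
    congr 1
    ring
  refine ⟨fun a β Υ _ _ => ?_, h_true⟩
  set g : H → ℝ := fun x => (α₀ - a + ⟪β₀, x - μ⟫ + ⟪x - μ, Υ₀ (x - μ)⟫ - ⟪x - μ, β⟫
    - ⟪x - μ, Υ (x - μ)⟫) / σ₀ with hg
  have g_meas : Measurable g := Continuous.measurable (by fun_prop)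
  have h_le := hdens.integral_rho_le_of_indepFun hε (g_meas.comp hX)
    (hindep.comp measurable_id g_meas) hρ₁ (σ₀ / σ)
  rw [h_true]
  convert h_le using 1
  · refine integral_congr_ae (.of_forall fun ω => ?_)
    dsimp only
    congr 1
    ring
  · refine integral_congr_ae (.of_forall fun ω => ?_)
    simp only [hmodel, hg, Function.comp_apply]
    congr 1
    field_simp
    ring
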